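/- arXiv:2501.12321 — 6 statements merged into one kernel-verified Lean document; each statement's English description precedes it below -/
import Mathlib

section
/- Let p be a prime, G a group, and H a proper subgroup of G that is p-separable in G. Then there exists a normal subgroup N of G with H ≤ N and with N of index exactly p in G. In particular, the normal closure of H is a proper subgroup of G. -/
/-- A subgroup `H` of a group `G` is `p`-separable if every `g ∈ G` outside `H` can be
separated from `H` by a homomorphism to a finite `p`-group (a finite group whose cardinality
is a power of `p`). -/
def IsPSeparable (p : ℕ) {G : Type*} [Group G] (H : Subgroup G) : Prop :=
  ∀ g : G, g ∉ H → ∃ (F : Type) (_ : Group F) (_ : Fintype F),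
    (∃ n : ℕ, Fintype.card F = p ^ n) ∧ ∃ f : G →* F, f g ∉ ⇑f '' (H : Set G)

/-- A maximal subgroup of a finite `p`-group has index `p`. -/
theorem IsPGroup.index_eq_of_isCoatom {p : ℕ} [Fact p.Prime] {P : Type*} [Group P] [Finite P]
    (hP : IsPGroup p P) {M : Subgroup P} (hM : IsCoatom M) : M.index = p := by
  obtain ⟨m, hm⟩ := IsPGroup.iff_card.mp (hP.to_subgroup M)
  obtain ⟨k, hk⟩ := hP.index M
  have hk0 : k ≠ 0 := by
    rintro rfl
    exact hM.1 (Subgroup.index_eq_one.mp (by simpa using hk))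
  have hcard : Nat.card P = p ^ m * p ^ k := by rw [← hm, ← hk, M.card_mul_index]
  have hp : p.Prime := Fact.out
  obtain ⟨K, hK, hMK⟩ := Sylow.exists_subgroup_card_pow_succ (p := p) (n := m)
    (by rw [hcard, ← pow_add]; exact pow_dvd_pow p (by omega)) hm
  have hlt : M < K := lt_of_le_of_ne hMK <| by
    rintro rfl
    exact absurd (Nat.pow_right_injective hp.two_le (hm.symm.trans hK)) (by simp)
  rw [hM.2 K hlt, Subgroup.card_top, hcard, pow_succ] at hK
  rw [hk]
  exact Nat.eq_of_mul_eq_mul_left (pow_pos hp.pos m) hK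

/-- Every proper subgroup of a finite `p`-group lies in a normal subgroup of index `p`. -/
theorem IsPGroup.exists_normal_index_eq {p : ℕ} [Fact p.Prime] {P : Type*} [Group P] [Finite P]
    (hP : IsPGroup p P) {K : Subgroup P} (hK : K ≠ ⊤) :
    ∃ M : Subgroup P, M.Normal ∧ K ≤ M ∧ M.index = p := by
  obtain ⟨M, hM, hKM⟩ := (eq_top_or_exists_le_coatom K).resolve_left hK
  have := hP.isNilpotent
  exact ⟨M, Subgroup.NormalizerCondition.normal_of_coatom M
    Group.normalizerCondition_of_isNilpotent hM, hKM, hP.index_eq_of_isCoatom hM⟩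

/-- If `H` is a proper `p`-separable subgroup of `G` (`p` prime), then `H` is contained in a
normal subgroup of `G` of index exactly `p`; in particular the normal closure of `H` is a
proper subgroup of `G`. -/
theorem proper_p_separable_subgroup_le_normal_of_index_p
    {G : Type*} [Group G] (p : ℕ) (hp : p.Prime) (H : Subgroup G) (hH : H ≠ ⊤)
    (hsep : IsPSeparable p H) :
    (∃ N : Subgroup G, N.Normal ∧ H ≤ N ∧ N.index = p) ∧
      Subgroup.normalClosure (H : Set G) ≠ ⊤ := by
  have : Fact p.Prime := ⟨hp⟩
  have hN : ∃ N : Subgroup G, N.Normal ∧ H ≤ N ∧ N.index = p := by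
    obtain ⟨g, hg⟩ : ∃ g, g ∉ H := by
      by_contra! h
      exact hH (eq_top_iff.mpr fun g _ => h g)
    obtain ⟨F, _, _, ⟨n, hn⟩, f, hf⟩ := hsep g hg
    have hF : IsPGroup p F := IsPGroup.of_card (n := n) (by rw [Nat.card_eq_fintype_card, hn])
    have hK : H.map f.rangeRestrict ≠ ⊤ := by
      intro h
      obtain ⟨x, hx, hxg⟩ : f.rangeRestrict g ∈ H.map f.rangeRestrict := h ▸ Subgroup.mem_top _
      exact hf ⟨x, hx, congrArg Subtype.val hxg⟩
    obtain ⟨M, hM, hKM, hMp⟩ := (hF.to_subgroup f.range).exists_normal_index_eq hK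
    exact ⟨M.comap f.rangeRestrict, hM.comap _, Subgroup.map_le_iff_le_comap.mp hKM,
      (M.index_comap_of_surjective f.rangeRestrict_surjective).trans hMp⟩
  refine ⟨hN, fun htop => ?_⟩
  obtain ⟨N, hNn, hHN, hNp⟩ := hN
  have : N = ⊤ := top_le_iff.mp (htop ▸ Subgroup.normalClosure_le_normal hHN)
  rw [this, Subgroup.index_top] at hNp
  exact hp.one_lt.ne hNp
end

section
/- Let p be a prime and let G be a residually p-finite group, i.e. for every g ∈ G with g ≠ 1 there exist a finite p-group F and a group homomorphism f : G → F with f(g) ≠ 1. Let r : G → G be a group endomorphism with r ∘ r = r. Then the image of r is a p-separable subgroup of G. -/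
/-- If `G` is residually `p`-finite and `r : G → G` is an idempotent group endomorphism
(a retraction), then the image of `r` is `p`-separable in `G`. -/
theorem range_of_retraction_isPSeparable
    {G : Type*} [Group G] (p : ℕ) (hp : p.Prime)
    (hres : ∀ g : G, g ≠ 1 → ∃ (F : Type) (_ : Group F) (_ : Fintype F),
      (∃ n : ℕ, Fintype.card F = p ^ n) ∧ ∃ f : G →* F, f g ≠ 1)
    (r : G →* G) (hr : ∀ x : G, r (r x) = r x) :
    IsPSeparable p r.range := by
  intro g hg
  have hne : g⁻¹ * r g ≠ 1 := fun h => hg ⟨g, (inv_mul_eq_one.mp h).symm⟩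
  obtain ⟨F, hF, hFin, ⟨n, hn⟩, f, hf⟩ := hres _ hne
  refine ⟨F × F, inferInstance, inferInstance, ⟨n + n, ?_⟩, f.prod (f.comp r), ?_⟩
  · rw [Fintype.card_prod, hn, pow_add]
  · rintro ⟨_, ⟨x, rfl⟩, hx⟩
    simp only [MonoidHom.prod_apply, MonoidHom.comp_apply, hr, Prod.mk.injEq] at hx
    exact hf (by rw [map_mul, map_inv, ← hx.1, ← hx.2, inv_mul_cancel])
end

section
/- Let H be a group with trivial center, let N ∈ ℕ, let A = ℤᴺ (written additively), and set G = H × A. Then a map χ : G → G is an automorphism of G if and only if there exist an automorphism φ of H, an automorphism ψ of A, and a group homomorphism α : H → A such that χ(h, a) = (φ(h), α(h) + ψ(a)) for all h ∈ H and a ∈ A. -/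
namespace MulEquiv

variable {H A : Type*} [Group H] [CommGroup A]

/-- An automorphism of `H × A` maps the central factor `A` into `A` when `H` is centerless. -/
theorem fst_apply_one_prod (hcenter : Subgroup.center H = ⊥) (e : H × A ≃* H × A) (a : A) :
    (e (1, a)).1 = 1 := by
  rw [← Subgroup.mem_bot, ← hcenter, Subgroup.mem_center_iff]
  intro g
  obtain ⟨y, hy⟩ := e.surjective (g, 1)
  have hcomm : y * (1, a) = (1, a) * y := Prod.ext (by simp) (mul_comm _ _)
  have himage := congrArg (fun z => (e z).1) hcomm
  simpa [map_mul, hy] using himage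

theorem fst_apply_prod (hcenter : Subgroup.center H = ⊥) (e : H × A ≃* H × A) (h : H) (a : A) :
    (e (h, a)).1 = (e (h, 1)).1 := by
  have hsplit : ((h, a) : H × A) = (h, 1) * (1, a) := by simp
  rw [hsplit, map_mul, Prod.fst_mul, fst_apply_one_prod hcenter, mul_one]

theorem apply_one_prod (hcenter : Subgroup.center H = ⊥) (e : H × A ≃* H × A) (a : A) :
    e (1, a) = (1, (e (1, a)).2) :=
  Prod.ext (fst_apply_one_prod hcenter e a) rfl

/-- The automorphism of the centerless factor `H` induced by an automorphism of `H × A`. -/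
def fstOfCenterless (hcenter : Subgroup.center H = ⊥) (e : H × A ≃* H × A) : H ≃* H where
  toFun h := (e (h, 1)).1
  invFun h := (e.symm (h, 1)).1
  left_inv h := by
    beta_reduce
    rw [← fst_apply_prod hcenter e.symm _ (e (h, 1)).2, Prod.mk.eta, symm_apply_apply]
  right_inv h := by
    beta_reduce
    rw [← fst_apply_prod hcenter e _ (e.symm (h, 1)).2, Prod.mk.eta, apply_symm_apply]
  map_mul' h k := by
    rw [← Prod.fst_mul, ← map_mul, Prod.mk_mul_mk, one_mul]

/-- The automorphism of `A` obtained by restricting an automorphism of `H × A`, where `H` is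
centerless. -/
def sndOfCenterless (hcenter : Subgroup.center H = ⊥) (e : H × A ≃* H × A) : A ≃* A where
  toFun a := (e (1, a)).2
  invFun a := (e.symm (1, a)).2
  left_inv a := by
    beta_reduce
    rw [← apply_one_prod hcenter e, symm_apply_apply]
  right_inv a := by
    beta_reduce
    rw [← apply_one_prod hcenter e.symm, apply_symm_apply]
  map_mul' a b := by
    rw [← Prod.snd_mul, ← map_mul, Prod.mk_mul_mk, one_mul]

theorem apply_prod_of_centerless (hcenter : Subgroup.center H = ⊥) (e : H × A ≃* H × A)
    (h : H) (a : A) :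
    e (h, a) = (fstOfCenterless hcenter e h, (e (h, 1)).2 * sndOfCenterless hcenter e a) := by
  refine Prod.ext (fst_apply_prod hcenter e h a) ?_
  change _ = (e (h, 1)).2 * (e (1, a)).2
  rw [← Prod.snd_mul, ← map_mul, Prod.mk_mul_mk, one_mul, mul_one]

end MulEquiv


/-- Let `H` be a group with trivial center, `A = ℤᴺ`, and `G = H × A`. A map `χ : G → G`
is an automorphism of `G` if and only if there are an automorphism `φ` of `H`, an
automorphism `ψ` of `A` and a homomorphism `α : H → A` such that
`χ(h, a) = (φ(h), α(h) + ψ(a))` for all `h, a`. -/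
theorem automorphisms_of_product_with_free_abelian
    {H : Type*} [Group H] (hcenter : Subgroup.center H = ⊥) (N : ℕ)
    (χ : H × Multiplicative (Fin N → ℤ) → H × Multiplicative (Fin N → ℤ)) :
    (Function.Bijective χ ∧ ∀ x y, χ (x * y) = χ x * χ y) ↔
      ∃ (φ : H ≃* H) (ψ : (Fin N → ℤ) ≃+ (Fin N → ℤ))
        (α : H →* Multiplicative (Fin N → ℤ)),
        ∀ (h : H) (a : Fin N → ℤ),
          χ (h, Multiplicative.ofAdd a) =
            (φ h, Multiplicative.ofAdd (Multiplicative.toAdd (α h) + ψ a)) := by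
  constructor
  · rintro ⟨hbij, hmul⟩
    let e : H × Multiplicative (Fin N → ℤ) ≃* H × Multiplicative (Fin N → ℤ) :=
      { Equiv.ofBijective χ hbij with map_mul' := hmul }
    exact ⟨e.fstOfCenterless hcenter, AddEquiv.toMultiplicative.symm (e.sndOfCenterless hcenter),
      (MonoidHom.snd _ _).comp (e.toMonoidHom.comp (MonoidHom.inl _ _)),
      fun h a => e.apply_prod_of_centerless hcenter h (Multiplicative.ofAdd a)⟩
  · rintro ⟨φ, ψ, α, hχ⟩
    refine ⟨⟨?_, ?_⟩, ?_⟩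
    · rintro ⟨h, a⟩ ⟨k, b⟩ heq
      have heq' := (hχ h a.toAdd).symm.trans (heq.trans (hχ k b.toAdd))
      obtain ⟨hfst, hsnd⟩ := Prod.mk.inj heq'
      obtain rfl := φ.injective hfst
      have hab : a.toAdd = b.toAdd :=
        ψ.injective (add_left_cancel (Multiplicative.ofAdd.injective hsnd))
      exact Prod.ext rfl (Multiplicative.toAdd.injective hab)
    · rintro ⟨k, b⟩
      refine ⟨(φ.symm k, Multiplicative.ofAdd (ψ.symm (b.toAdd - (α (φ.symm k)).toAdd))), ?_⟩
      rw [hχ, φ.apply_symm_apply, ψ.apply_symm_apply, add_sub_cancel, ofAdd_toAdd]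
    · rintro ⟨h, a⟩ ⟨k, b⟩
      have hprod := hχ (h * k) (a.toAdd + b.toAdd)
      rw [map_mul, map_mul, ψ.map_add, toAdd_mul, add_add_add_comm] at hprod
      exact hprod.trans (congrArg₂ (· * ·) (hχ h a.toAdd) (hχ k b.toAdd)).symm
end

section
/- Let H be a group with trivial center generated by a finite set S_H, let N ∈ ℕ, let A = ℤᴺ, and set G = H × A, generated by the finite set S consisting of the elements (s, 0) for s ∈ S_H together with (1, ±eᵢ) for the standard basis vectors eᵢ of A. Let χ be the automorphism of G given by χ(h, a) = (φ(h), α(h) + ψ(a)), where φ is an automorphism of H, ψ is an automorphism of A, and α : H → A is a group homomorphism. Let V be the quotient of the abelianization of G by its torsion subgroup, let q : G → V be the natural projection, let χ̄ be the (unique) automorphism of V with χ̄ ∘ q = q ∘ χ, and equip V with the word length |·| relative to the finite generating set q(S). Then there exists a constant C ≥ 1 such that for every g = (h, a) ∈ G and every n ∈ ℕ: C⁻¹·(|φⁿ(h)|_{S_H} + |χ̄ⁿ(q(g))|) ≤ |χⁿ(g)|_S ≤ C·(|φⁿ(h)|_{S_H} + |χ̄ⁿ(q(g))|), and also C⁻¹·(‖φⁿ(h)‖_{S_H}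 + |χ̄ⁿ(q(g))|) ≤ ‖χⁿ(g)‖_S ≤ C·(‖φⁿ(h)‖_{S_H} + |χ̄ⁿ(q(g))|). Moreover, for every g ∈ G with q(g) ≠ 0 there exist p ∈ ℕ and a real algebraic integer λ ≥ 1 such that the sequence n ↦ |χ̄ⁿ(q(g))| is bi-Lipschitz equivalent, for n ≥ 1, to the sequence n ↦ nᵖ·λⁿ. -/
/-- The word length of `g ∈ G` with respect to a generating set `S ⊆ G`: the least `n` such
that `g` is a product of `n` elements of `S ∪ S⁻¹` (with the empty product giving `1`). -/
noncomputable def wordLength {G : Type*} [Group G] (S : Set G) (g : G) : ℕ :=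
  sInf {n : ℕ | ∃ l : List G, l.length = n ∧ (∀ x ∈ l, x ∈ S ∨ x⁻¹ ∈ S) ∧ l.prod = g}

/-- The conjugacy length of `g ∈ G`: the minimal word length of a conjugate of `g`. -/
noncomputable def conjLength {G : Type*} [Group G] (S : Set G) (g : G) : ℕ :=
  sInf (Set.range fun x : G => wordLength S (x * g * x⁻¹))

/-- The quotient of the abelianization of `G` by its torsion subgroup. -/
abbrev TorsionFreeAbelianization (G : Type*) [Group G] :=
  Abelianization G ⧸ CommGroup.torsion (Abelianization G)

/-- The natural projection of `G` onto the quotient of its abelianization by torsion. -/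
def torsionFreeAbelianizationProj (G : Type*) [Group G] :
    G →* TorsionFreeAbelianization G :=
  (QuotientGroup.mk' (CommGroup.torsion (Abelianization G))).comp Abelianization.of

section Growth

open Asymptotics Filter Topology

/-- The expansion of `Tⁿ v` by powers of the nilpotent part of `T`. -/
theorem Module.End.pow_apply_eq_sum_choose {K E : Type*} [Field K] [AddCommGroup E] [Module K E]
    (M : Module.End K E) {v : E} {p : ℕ} (hv : (M ^ (p + 1)) v = 0) (n : ℕ) :
    ((1 + M) ^ n) v = ∑ k ∈ Finset.range (p + 1), (n.choose k : K) • (M ^ k) v := by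
  have hzero : ∀ k, p + 1 ≤ k → (M ^ k) v = 0 := fun k hk => by
    obtain ⟨j, rfl⟩ := Nat.exists_eq_add_of_le' hk
    rw [pow_add, Module.End.mul_apply, hv, map_zero]
  have h1 : ((1 + M) ^ n) v = ∑ k ∈ Finset.range (n + 1), (n.choose k : K) • (M ^ k) v := by
    rw [add_comm, (Commute.one_right M).add_pow]
    simp [LinearMap.sum_apply, Module.End.mul_apply, ← Nat.cast_smul_eq_nsmul K]
  rw [h1, Finset.sum_subset (Finset.range_subset_range.2 (le_max_left (n + 1) (p + 1))),
    Finset.sum_subset (Finset.range_subset_range.2 (le_max_right (n + 1) (p + 1)))]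
  · intro k _ hk
    rw [hzero k (by simpa using hk), smul_zero]
  · intro k _ hk
    rw [Nat.choose_eq_zero_of_lt (by simp at hk; omega), Nat.cast_zero, zero_smul]

theorem isLittleO_natCast_pow {k p : ℕ} (h : k < p) :
    (fun n : ℕ => (n : ℝ) ^ k) =o[atTop] fun n : ℕ => (n : ℝ) ^ p :=
  (isLittleO_pow_pow_atTop_of_lt h).comp_tendsto tendsto_natCast_atTop_atTop

theorem Module.End.isTheta_one_add_pow_apply {E : Type*} [NormedAddCommGroup E] [NormedSpace ℂ E]
    (M : Module.End ℂ E) {v : E} {p : ℕ} (hv : (M ^ (p + 1)) v = 0) (hv' : (M ^ p) v ≠ 0) :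
    (fun n : ℕ => ((1 + M) ^ n) v) =Θ[atTop] fun n : ℕ => (n : ℝ) ^ p := by
  have hterm : ∀ (k : ℕ) (w : E), (fun n : ℕ => (n.choose k : ℂ) • w) =O[atTop]
      fun n : ℕ => (n : ℝ) ^ k := fun k w => by
    refine IsBigO.trans ?_ (isTheta_choose k).1
    refine IsBigO.of_bound ‖w‖ (Eventually.of_forall fun n => ?_)
    simp [norm_smul, mul_comm]
  simp_rw [M.pow_apply_eq_sum_choose hv, Finset.sum_range_succ]
  have hlow : (fun n : ℕ => ∑ k ∈ Finset.range p, (n.choose k : ℂ) • (M ^ k) v) =o[atTop]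
      fun n : ℕ => (n : ℝ) ^ p :=
    IsLittleO.fun_sum fun k hk =>
      (hterm k _).trans_isLittleO (isLittleO_natCast_pow (Finset.mem_range.1 hk))
  have hlead : (fun n : ℕ => (n.choose p : ℂ) • (M ^ p) v) =Θ[atTop] fun n : ℕ => (n : ℝ) ^ p := by
    refine ⟨hterm p _, (isTheta_choose p).2.trans ?_⟩
    refine IsBigO.of_bound ‖(M ^ p) v‖⁻¹ (Eventually.of_forall fun n => ?_)
    have := norm_ne_zero_iff.2 hv'
    simp [norm_smul]
    field_simp
    rfl
  have hlow' := hlow.trans_isTheta hlead.symm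
  exact ⟨hlow.isBigO.add hlead.1, hlead.2.trans hlow'.right_isBigO_add⟩

theorem Module.End.isTheta_pow_apply_of_mem_maxGenEigenspace {E : Type*} [NormedAddCommGroup E]
    [NormedSpace ℂ E] (T : Module.End ℂ E) {μ : ℂ} (hμ : μ ≠ 0) {v : E}
    (hv : v ∈ T.maxGenEigenspace μ) (hv0 : v ≠ 0) :
    ∃ p : ℕ, (fun n : ℕ => (T ^ n) v) =Θ[atTop] fun n : ℕ => (n : ℝ) ^ p * ‖μ‖ ^ n := by
  classical
  rw [Module.End.mem_maxGenEigenspace] at hv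
  set M : Module.End ℂ E := μ⁻¹ • (T - μ • 1) with hM
  have hT : T = μ • (1 + M) := by
    rw [hM, smul_add, smul_smul, mul_inv_cancel₀ hμ, one_smul, add_sub_cancel]
  have hMv : ∃ k, (M ^ k) v = 0 := by
    obtain ⟨k, hk⟩ := hv
    exact ⟨k, by rw [hM, smul_pow, LinearMap.smul_apply, hk, smul_zero]⟩
  obtain ⟨p, hp⟩ : ∃ p, Nat.find hMv = p + 1 := Nat.exists_eq_succ_of_ne_zero fun h => by
    have := Nat.find_spec hMv
    rw [h] at this
    exact hv0 (by simpa using this)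
  have h1 : (M ^ (p + 1)) v = 0 := hp ▸ Nat.find_spec hMv
  have h2 : (M ^ p) v ≠ 0 := Nat.find_min hMv (by omega)
  refine ⟨p, ?_⟩
  have h3 : (fun n : ℕ => (T ^ n) v) = fun n : ℕ => μ ^ n • ((1 + M) ^ n) v := by
    ext n
    rw [hT, smul_pow, LinearMap.smul_apply]
  rw [h3]
  have h4 : (fun n : ℕ => μ ^ n) =Θ[atTop] fun n : ℕ => ‖μ‖ ^ n :=
    IsTheta.of_norm_eventuallyEq_norm (by simp)
  have := h4.smul (M.isTheta_one_add_pow_apply h1 h2)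
  simpa [mul_comm] using this

theorem isBigO_pow_mul_pow_of_toLex_le {p p' : ℕ} {r r' : ℝ} (hr : 0 ≤ r)
    (h : toLex (r, p) ≤ toLex (r', p')) :
    (fun n : ℕ => (n : ℝ) ^ p * r ^ n) =O[atTop] fun n : ℕ => (n : ℝ) ^ p' * r' ^ n := by
  rcases Prod.Lex.toLex_le_toLex.1 h with h | ⟨h, h'⟩
  · dsimp at h
    refine (isLittleO_pow_const_mul_const_pow_const_pow_of_norm_lt p
      (by rwa [Real.norm_of_nonneg hr])).isBigO.trans ?_
    refine IsBigO.of_bound 1 (eventually_ge_atTop 1 |>.mono fun n hn => ?_)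
    have : (1 : ℝ) ≤ (n : ℝ) ^ p' := one_le_pow₀ (by exact_mod_cast hn)
    have h0 : 0 ≤ r' ^ n := by have := hr.trans h.le; positivity
    rw [Real.norm_of_nonneg h0, Real.norm_of_nonneg (by positivity)]
    nlinarith
  · dsimp at h h'
    subst h
    refine IsBigO.mul ?_ (isBigO_refl _ _)
    rcases h'.lt_or_eq with h' | rfl
    · exact (isLittleO_natCast_pow h').isBigO
    · exact isBigO_refl _ _

theorem Module.End.exists_isTheta_pow_apply {E : Type*} [NormedAddCommGroup E] [NormedSpace ℂ E]
    [FiniteDimensional ℂ E] (T : Module.End ℂ E) (hT : Function.Injective T) {v : E}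
    (hv : v ≠ 0) :
    ∃ (p : ℕ) (μ : ℂ), T.HasEigenvalue μ ∧
      (fun n : ℕ => (T ^ n) v) =Θ[atTop] fun n : ℕ => (n : ℝ) ^ p * ‖μ‖ ^ n := by
  have htop := T.iSup_maxGenEigenspace_eq_top
  obtain ⟨f, hf, hfv⟩ := (Submodule.mem_iSup_iff_exists_finsupp _ v).1
    (htop ▸ Submodule.mem_top : v ∈ ⨆ μ : ℂ, T.maxGenEigenspace μ)
  have heig : ∀ μ ∈ f.support, T.HasEigenvalue μ := fun μ hμ => by
    by_contra h
    have hbot : T.maxGenEigenspace μ = ⊥ := by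
      by_contra h'
      obtain ⟨k, hk⟩ : ∃ k : ℕ, T.genEigenspace μ k ≠ ⊥ := by
        by_contra! h''
        exact h' (by rw [← Module.End.iSup_genEigenspace_eq]; simp [h''])
      exact h (Module.End.hasEigenvalue_of_hasGenEigenvalue (k := k) hk)
    have := hf μ
    rw [hbot, Submodule.mem_bot] at this
    exact Finsupp.mem_support_iff.1 hμ this
  have hne : ∀ μ ∈ f.support, μ ≠ 0 := fun μ hμ h0 => by
    obtain ⟨x, hx⟩ := (heig μ hμ).exists_hasEigenvector
    refine hx.2 (hT ?_)
    rw [hx.apply_eq_smul, h0, zero_smul, map_zero]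
  have hgrow : ∀ μ, ∃ p : ℕ, μ ∈ f.support →
      (fun n : ℕ => (T ^ n) (f μ)) =Θ[atTop] fun n : ℕ => (n : ℝ) ^ p * ‖μ‖ ^ n := fun μ => by
    by_cases hμ : μ ∈ f.support
    · obtain ⟨p, hp⟩ := T.isTheta_pow_apply_of_mem_maxGenEigenspace (hne μ hμ) (hf μ)
        (Finsupp.mem_support_iff.1 hμ)
      exact ⟨p, fun _ => hp⟩
    · exact ⟨0, fun h => absurd h hμ⟩
  choose p hp using hgrow
  have hsupp : f.support.Nonempty := by
    rw [Finset.nonempty_iff_ne_empty]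
    intro h
    rw [Finsupp.support_eq_empty] at h
    exact hv (by rw [← hfv, h]; simp)
  obtain ⟨μ, hμ, hmax⟩ := f.support.exists_max_image (fun μ => toLex (‖μ‖, p μ)) hsupp
  refine ⟨p μ, μ, heig μ hμ, ?_, ?_⟩
  · have : (fun n : ℕ => (T ^ n) v) = fun n : ℕ => ∑ ν ∈ f.support, (T ^ n) (f ν) := by
      ext n
      rw [← map_sum, ← hfv]
      rfl
    rw [this]
    exact IsBigO.fun_sum fun ν hν =>
      (hp ν hν).1.trans (isBigO_pow_mul_pow_of_toLex_le (norm_nonneg _) (hmax ν hν))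
  · have hcompl : IsCompl (T.maxGenEigenspace μ) (⨆ ν, ⨆ (_ : ν ≠ μ), T.maxGenEigenspace ν) := by
      refine ⟨T.independent_maxGenEigenspace μ, codisjoint_iff.2 ?_⟩
      rw [eq_top_iff, ← htop]
      refine iSup_le fun ν => ?_
      by_cases h : ν = μ
      · exact h ▸ le_sup_left
      · exact (le_iSup₂_of_le (f := fun ν (_ : ν ≠ μ) => T.maxGenEigenspace ν) ν h le_rfl).trans
          le_sup_right
    set P := Submodule.projection _ _ hcompl
    have hmaps : ∀ (n : ℕ) (ν : ℂ), (T ^ n) (f ν) ∈ T.maxGenEigenspace ν := fun n ν =>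
      T.mapsTo_maxGenEigenspace_of_comm ((Commute.refl T).pow_right n) ν (hf ν)
    have hproj : ∀ n, P ((T ^ n) v) = (T ^ n) (f μ) := fun n => by
      rw [← hfv, Finsupp.sum, map_sum, map_sum, Finset.sum_eq_single μ]
      · exact Submodule.projection_apply_of_mem_left hcompl (hmaps n μ)
      · intro ν _ hν
        refine Submodule.projection_apply_of_mem_right hcompl ?_
        exact (le_iSup₂_of_le (f := fun ν (_ : ν ≠ μ) => T.maxGenEigenspace ν) ν hν le_rfl)
          (hmaps n ν)
      · exact fun h => absurd hμ h
    refine (hp μ hμ).2.trans ?_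
    simp_rw [← hproj]
    exact (LinearMap.toContinuousLinearMap P).isBigO_comp _ _

theorem isIntegral_norm {μ : ℂ} (h : IsIntegral ℤ μ) : IsIntegral ℤ ‖μ‖ := by
  have hconj : IsIntegral ℤ ((starRingEnd ℂ) μ) := h.map (starRingEnd ℂ).toIntAlgHom
  have h2 : IsIntegral ℤ (algebraMap ℝ ℂ (‖μ‖ ^ 2)) := by
    have := h.mul hconj
    rw [Complex.mul_conj, Complex.normSq_eq_norm_sq] at this
    exact this
  rw [isIntegral_algebraMap_iff (FaithfulSMul.algebraMap_injective ℝ ℂ)] at h2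
  exact h2.of_pow two_pos

theorem exists_list_prod_eq_of_closure_eq_top {G : Type*} [Group G] {S : Set G}
    (hS : Subgroup.closure S = ⊤) (g : G) :
    ∃ l : List G, l.length = wordLength S g ∧ (∀ x ∈ l, x ∈ S ∨ x⁻¹ ∈ S) ∧ l.prod = g := by
  have hg : g ∈ (Subgroup.closure S).toSubmonoid := hS ▸ Subgroup.mem_top g
  rw [Subgroup.closure_toSubmonoid] at hg
  obtain ⟨l, hl, hg⟩ := Submonoid.exists_list_of_mem_closure hg
  exact Nat.sInf_mem (s := {n : ℕ | ∃ l : List G, l.length = n ∧ (∀ x ∈ l, x ∈ S ∨ x⁻¹ ∈ S) ∧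
    l.prod = g}) ⟨l.length, l, rfl, hl, hg⟩

theorem wordLength_prod_le {G : Type*} [Group G] {S : Set G} (l : List G)
    (hl : ∀ x ∈ l, x ∈ S ∨ x⁻¹ ∈ S) : wordLength S l.prod ≤ l.length :=
  Nat.sInf_le ⟨l, rfl, hl, rfl⟩

@[simp]
theorem wordLength_one {G : Type*} [Group G] (S : Set G) : wordLength S (1 : G) = 0 :=
  Nat.le_zero.1 (wordLength_prod_le [] (by simp))

theorem wordLength_le_one {G : Type*} [Group G] {S : Set G} {x : G} (hx : x ∈ S ∨ x⁻¹ ∈ S) :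
    wordLength S x ≤ 1 := by
  simpa using wordLength_prod_le [x] (by simpa using hx)

theorem wordLength_mul_le {G : Type*} [Group G] {S : Set G} (hS : Subgroup.closure S = ⊤)
    (g h : G) : wordLength S (g * h) ≤ wordLength S g + wordLength S h := by
  obtain ⟨l, hl, hlS, rfl⟩ := exists_list_prod_eq_of_closure_eq_top hS g
  obtain ⟨m, hm, hmS, rfl⟩ := exists_list_prod_eq_of_closure_eq_top hS h
  rw [← hl, ← hm, ← List.prod_append, ← List.length_append]
  refine wordLength_prod_le _ fun x hx => ?_
  exact (List.mem_append.1 hx).elim (hlS x) (hmS x)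

/-- A subadditive function is bounded by the word length times its maximum on the generators. -/
theorem le_mul_wordLength {G : Type*} [Group G] {S : Set G} (hS : Subgroup.closure S = ⊤)
    {f : G → ℝ} (hone : f 1 ≤ 0) (hmul : ∀ x y, f (x * y) ≤ f x + f y) {c : ℝ}
    (hc : ∀ x ∈ S, f x ≤ c ∧ f x⁻¹ ≤ c) (g : G) : f g ≤ c * wordLength S g := by
  obtain ⟨l, hl, hlS, hg⟩ := exists_list_prod_eq_of_closure_eq_top hS g
  rw [← hl, ← hg]
  clear hl hg
  induction l with
  | nil => simpa using hone
  | cons x l ih =>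
    have hx : f x ≤ c := by
      rcases hlS x (by simp) with h | h
      · exact (hc x h).1
      · simpa using (hc _ h).2
    have := ih fun y hy => hlS y (by simp [hy])
    rw [List.prod_cons, List.length_cons]
    push_cast
    linarith [hmul x l.prod]

theorem wordLength_map_le {G G' : Type*} [Group G] [Group G'] {S : Set G} {S' : Set G'}
    (hS : Subgroup.closure S = ⊤) (hS' : Subgroup.closure S' = ⊤) (f : G →* G')
    (hf : ∀ x ∈ S, f x ∈ S' ∨ f x = 1) (g : G) : wordLength S' (f g) ≤ wordLength S g := by
  have hle : ∀ x ∈ S, wordLength S' (f x) ≤ 1 ∧ wordLength S' (f x⁻¹) ≤ 1 := fun x hx => by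
    rcases hf x hx with h | h
    · exact ⟨wordLength_le_one (.inl h), wordLength_le_one (.inr (by simpa using h))⟩
    · simp [h]
  have := le_mul_wordLength hS (f := fun g => (wordLength S' (f g) : ℝ)) (c := 1) (by simp)
    (fun x y => by rw [map_mul]; exact_mod_cast wordLength_mul_le hS' _ _)
    (fun x hx => by exact_mod_cast hle x hx) g
  rw [one_mul] at this
  exact_mod_cast this

theorem wordLength_inv_le {G : Type*} [Group G] {S : Set G} (hS : Subgroup.closure S = ⊤)
    (g : G) : wordLength S g⁻¹ ≤ wordLength S g := by
  have := le_mul_wordLength hS (f := fun g => (wordLength S g⁻¹ : ℝ)) (c := 1) (by simp)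
    (fun x y => by
      rw [mul_inv_rev, add_comm]
      exact_mod_cast wordLength_mul_le hS _ _)
    (fun x hx => ⟨by exact_mod_cast wordLength_le_one (.inr (by simpa using hx)),
      by exact_mod_cast wordLength_le_one (.inl (by simpa using hx))⟩) g
  rw [one_mul] at this
  exact_mod_cast this

theorem apply_prod_zpow_le_of_subadditive {A ι : Type*} [CommGroup A] {f : A → ℝ}
    (hone : f 1 ≤ 0) (hmul : ∀ x y, f (x * y) ≤ f x + f y) (hinv : ∀ x, f x⁻¹ ≤ f x)
    (s : Finset ι) (x : ι → A) (n : ι → ℤ) :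
    f (∏ i ∈ s, x i ^ n i) ≤ ∑ i ∈ s, |(n i : ℝ)| * f (x i) := by
  have hpow : ∀ (y : A) (k : ℕ), f (y ^ k) ≤ k * f y := fun y k => by
    induction k with
    | zero => simpa using hone
    | succ k ih =>
      rw [pow_succ]
      push_cast
      linarith [hmul (y ^ k) y]
  have hzpow : ∀ (y : A) (k : ℤ), f (y ^ k) ≤ |(k : ℝ)| * f y := fun y k => by
    obtain ⟨k, rfl | rfl⟩ := k.eq_nat_or_neg
    · simpa using hpow y k
    · simpa using (hinv _).trans (hpow y k)
  classical
  induction s using Finset.induction_on with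
  | empty => simpa using hone
  | insert i s hi ih =>
    rw [Finset.prod_insert hi, Finset.sum_insert hi]
    linarith [hmul (x i ^ n i) (∏ i ∈ s, x i ^ n i), hzpow (x i) (n i)]

theorem conjLength_le {G : Type*} [Group G] (S : Set G) (g x : G) :
    conjLength S g ≤ wordLength S (x * g * x⁻¹) :=
  Nat.sInf_le ⟨x, rfl⟩

theorem exists_wordLength_eq_conjLength {G : Type*} [Group G] (S : Set G) (g : G) :
    ∃ x : G, wordLength S (x * g * x⁻¹) = conjLength S g :=
  Nat.sInf_mem (Set.range_nonempty fun x : G => wordLength S (x * g * x⁻¹))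

theorem Matrix.isIntegral_of_hasEigenvalue {m : Type*} [Fintype m] [DecidableEq m]
    (M : Matrix m m ℤ) {μ : ℂ}
    (hμ : Module.End.HasEigenvalue (Matrix.toLin' (M.map (Int.castRingHom ℂ))) μ) : IsIntegral ℤ μ := by
  rw [Module.End.hasEigenvalue_iff_isRoot_charpoly, Matrix.charpoly_toLin', Matrix.charpoly_map,
    Polynomial.IsRoot, Polynomial.eval_map] at hμ
  exact ⟨M.charpoly, M.charpoly_monic, hμ⟩

/-- The length of the coordinate vector over `ℂ` is bi-Lipschitz equivalent to the word length. -/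
theorem exists_norm_coord_le_and_wordLength_le {V : Type*} [CommGroup V] {S : Set V}
    (hfin : S.Finite) (hS : Subgroup.closure S = ⊤) {m : Type*} [Fintype m]
    (b : Module.Basis m ℤ (Additive V)) :
    ∃ K L : ℝ, ∀ w : V,
      ‖fun i => ((b.repr (Additive.ofMul w) i : ℤ) : ℂ)‖ ≤ K * wordLength S w ∧
      (wordLength S w : ℝ) ≤ L * ‖fun i => ((b.repr (Additive.ofMul w) i : ℤ) : ℂ)‖ := by
  set ν : V → ℝ := fun w => ‖fun i => ((b.repr (Additive.ofMul w) i : ℤ) : ℂ)‖ with hν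
  obtain ⟨K, hK⟩ := (hfin.image ν).bddAbove
  refine ⟨K, ∑ i, (wordLength S (b i).toMul : ℝ), fun w => ⟨?_, ?_⟩⟩
  · refine le_mul_wordLength hS (f := ν) ?_ ?_ ?_ w
    · simp only [hν, ofMul_one, map_zero, Finsupp.coe_zero, Pi.zero_apply, Int.cast_zero]
      exact (norm_zero (E := m → ℂ)).le
    · intro x y
      simp only [hν, ofMul_mul, map_add, Finsupp.coe_add, Pi.add_apply, Int.cast_add]
      exact norm_add_le (fun i => ((b.repr (Additive.ofMul x) i : ℤ) : ℂ)) _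
    · intro x hx
      have h := hK (Set.mem_image_of_mem ν hx)
      refine ⟨h, le_of_eq_of_le ?_ h⟩
      simp only [hν, ofMul_inv, map_neg, Finsupp.coe_neg, Pi.neg_apply, Int.cast_neg]
      exact norm_neg (fun i => ((b.repr (Additive.ofMul x) i : ℤ) : ℂ))
  · have hw : w = ∏ i, (b i).toMul ^ (b.repr (Additive.ofMul w) i) := by
      have h := congrArg Additive.toMul (b.sum_repr (Additive.ofMul w)).symm
      simpa only [toMul_sum, toMul_zsmul, toMul_ofMul] using h
    have h := apply_prod_zpow_le_of_subadditive (f := fun w => (wordLength S w : ℝ)) (by simp)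
      (fun x y => by exact_mod_cast wordLength_mul_le hS x y)
      (fun x => by exact_mod_cast wordLength_inv_le hS x) Finset.univ
      (fun i => (b i).toMul) (fun i => b.repr (Additive.ofMul w) i)
    rw [← hw] at h
    refine h.trans ?_
    rw [Finset.sum_mul]
    refine Finset.sum_le_sum fun i _ => ?_
    rw [mul_comm]
    refine mul_le_mul_of_nonneg_left ?_ (by positivity)
    simpa using norm_le_pi_norm (fun i => ((b.repr (Additive.ofMul w) i : ℤ) : ℂ)) i

theorem one_le_of_isTheta_pow_mul_pow {u : ℕ → ℝ} {p : ℕ} {r : ℝ} (hr : 0 ≤ r)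
    (hu : ∀ n, 1 ≤ u n) (h : u =Θ[atTop] fun n : ℕ => (n : ℝ) ^ p * r ^ n) : 1 ≤ r := by
  by_contra! hr1
  have hlim : Tendsto u atTop (𝓝 0) :=
    h.1.trans_tendsto (tendsto_pow_const_mul_const_pow_of_lt_one p hr hr1)
  linarith [ge_of_tendsto' hlim hu]

theorem MulEquiv.exists_growth_of_commGroup {V : Type*} [CommGroup V] [IsMulTorsionFree V]
    {S : Set V} (hfin : S.Finite) (hS : Subgroup.closure S = ⊤) (f : V ≃* V) {w : V}
    (hw : w ≠ 1) :
    ∃ (p : ℕ) (r : ℝ), 1 ≤ r ∧ IsIntegral ℤ r ∧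
      ∃ C : ℝ, 0 < C ∧ ∀ n : ℕ, 1 ≤ n →
        (wordLength S (f^[n] w) : ℝ) ≤ C * ((n : ℝ) ^ p * r ^ n) ∧
        (n : ℝ) ^ p * r ^ n ≤ C * (wordLength S (f^[n] w) : ℝ) := by
  have : Group.FG V := ⟨⟨hfin.toFinset, by simpa using hS⟩⟩
  have : Module.Finite ℤ (Additive V) := Module.Finite.iff_addGroup_fg.2 inferInstance
  let b := Module.finBasis ℤ (Additive V)
  obtain ⟨K, L, hKL⟩ := exists_norm_coord_le_and_wordLength_le hfin hS b
  let ι : V → (Fin (Module.finrank ℤ (Additive V)) → ℂ) := fun w i =>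
    ((b.repr (Additive.ofMul w) i : ℤ) : ℂ)
  let F : Additive V ≃ₗ[ℤ] Additive V := (MulEquiv.toAdditive f).toIntLinearEquiv
  let M := LinearMap.toMatrix b b F.toLinearMap
  let T : Module.End ℂ (Fin (Module.finrank ℤ (Additive V)) → ℂ) :=
    Matrix.toLin' (M.map (Int.castRingHom ℂ))
  have hTinj : Function.Injective T := by
    let M' := LinearMap.toMatrix b b F.symm.toLinearMap
    have hMM : M' * M = 1 := by
      rw [← LinearMap.toMatrix_comp]
      simp
    have hMM' : M'.map (Int.castRingHom ℂ) * M.map (Int.castRingHom ℂ) = 1 := by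
      rw [← Matrix.map_mul, hMM]
      simp
    refine Function.LeftInverse.injective (g := Matrix.toLin' (M'.map (Int.castRingHom ℂ)))
      fun x => ?_
    rw [← Matrix.toLin'_mul_apply, hMM', Matrix.toLin'_one, LinearMap.id_apply]
  have hιT : ∀ x, ι (f x) = T (ι x) := fun x => by
    have h := LinearMap.toMatrix_mulVec_repr b b F.toLinearMap (Additive.ofMul x)
    ext i
    have hi := congrFun h i
    change ((b.repr (F (Additive.ofMul x)) i : ℤ) : ℂ) = _
    rw [LinearEquiv.coe_coe] at hi
    rw [← hi, Matrix.toLin'_apply]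
    simp [Matrix.mulVec, dotProduct, ι, M]
  have hιTn : ∀ n, ι (f^[n] w) = (T ^ n) (ι w) := fun n => by
    rw [Module.End.pow_apply]
    exact (Function.Semiconj.iterate_right (f := ι) hιT n) w
  have hιpos : ∀ x, x ≠ 1 → 1 ≤ ‖ι x‖ := fun x hx => by
    have hne : b.repr (Additive.ofMul x) ≠ 0 := by simpa using hx
    obtain ⟨i, hi⟩ := Finsupp.ne_iff.1 hne
    refine le_trans ?_ (norm_le_pi_norm (ι x) i)
    simp only [ι, Complex.norm_intCast]
    exact_mod_cast Int.one_le_abs hi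
  have hfn : ∀ n, f^[n] w ≠ 1 := fun n h => by
    refine hw (f.injective.iterate n (h.trans ?_))
    exact (Function.iterate_fixed (map_one f) n).symm
  have hιw : ι w ≠ 0 := fun h => by
    have := hιpos w hw
    rw [h, norm_zero] at this
    linarith
  obtain ⟨p, μ, hμ, hΘ⟩ := T.exists_isTheta_pow_apply hTinj hιw
  have hΘ' : (fun n => ‖ι (f^[n] w)‖) =Θ[atTop] fun n : ℕ => (n : ℝ) ^ p * ‖μ‖ ^ n := by
    simp_rw [hιTn]
    exact hΘ.norm_left
  have hwl : (fun n => (wordLength S (f^[n] w) : ℝ)) =Θ[atTop] fun n => ‖ι (f^[n] w)‖ :=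
    ⟨.of_bound L (.of_forall fun n => by simpa using (hKL _).2),
      .of_bound K (.of_forall fun n => by simpa using (hKL _).1)⟩
  have hr : 1 ≤ ‖μ‖ := one_le_of_isTheta_pow_mul_pow (norm_nonneg μ) (fun n => hιpos _ (hfn n)) hΘ'
  refine ⟨p, ‖μ‖, hr, isIntegral_norm (M.isIntegral_of_hasEigenvalue hμ), ?_⟩
  have hgrow := hwl.trans hΘ'
  obtain ⟨C₁, hC₁, h₁⟩ := bound_of_isBigO_nat_atTop hgrow.1
  obtain ⟨C₂, hC₂, h₂⟩ := bound_of_isBigO_nat_atTop hgrow.2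
  refine ⟨max C₁ C₂, lt_max_of_lt_left hC₁, fun n hn => ?_⟩
  have hn' : (0 : ℝ) < n := by exact_mod_cast hn
  have hpos : 0 < (n : ℝ) ^ p * ‖μ‖ ^ n := by positivity
  have hwpos : (wordLength S (f^[n] w) : ℝ) ≠ 0 := fun h => by
    have h1 := (hKL (f^[n] w)).1.trans' (hιpos _ (hfn n))
    rw [h, mul_zero] at h1
    linarith
  have h₁' := h₁ hpos.ne'
  have h₂' := h₂ hwpos
  rw [Real.norm_of_nonneg hpos.le, Real.norm_of_nonneg (Nat.cast_nonneg _)] at h₁' h₂'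
  exact ⟨h₁'.trans (mul_le_mul_of_nonneg_right (le_max_left _ _) hpos.le),
    h₂'.trans (mul_le_mul_of_nonneg_right (le_max_right _ _) (Nat.cast_nonneg _))⟩

end Growth

section ProductWithFreeAbelian

variable {H : Type*} [Group H] {S_H : Set H} {N : ℕ} {S : Set (H × Multiplicative (Fin N → ℤ))}

theorem ofAdd_eq_prod_zpow (a : Fin N → ℤ) :
    Multiplicative.ofAdd a = ∏ i, Multiplicative.ofAdd (Pi.single i (1 : ℤ)) ^ a i := by
  have h : a = ∑ i, a i • Pi.single i (1 : ℤ) := by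
    conv_lhs => rw [← Finset.univ_sum_single a]
    exact Finset.sum_congr rfl fun i _ => by rw [← Pi.single_smul]; simp
  conv_lhs => rw [h]
  simp only [ofAdd_sum, ofAdd_zsmul]

theorem closure_eq_top_of_prod (hgenH : Subgroup.closure S_H = ⊤)
    (hinl : ∀ s ∈ S_H, (s, 1) ∈ S)
    (hinr : ∀ i : Fin N, (1, Multiplicative.ofAdd (Pi.single i (1 : ℤ))) ∈ S) :
    Subgroup.closure S = ⊤ := by
  refine eq_top_iff.2 fun g _ => ?_
  have h1 : ((g.1, 1) : H × Multiplicative (Fin N → ℤ)) ∈ Subgroup.closure S := by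
    have hle : Subgroup.closure S_H ≤ (Subgroup.closure S).comap (MonoidHom.inl H _) :=
      (Subgroup.closure_le _).2 fun s hs => Subgroup.subset_closure (hinl s hs)
    exact hle (hgenH ▸ Subgroup.mem_top g.1)
  have h2 : ((1, g.2) : H × Multiplicative (Fin N → ℤ)) ∈ Subgroup.closure S := by
    change g.2 ∈ (Subgroup.closure S).comap (MonoidHom.inr H _)
    rw [← ofAdd_toAdd g.2, ofAdd_eq_prod_zpow]
    exact Subgroup.prod_mem _ fun i _ =>
      Subgroup.zpow_mem ((Subgroup.closure S).comap (MonoidHom.inr H _))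
        (Subgroup.subset_closure (hinr i)) _
  simpa using Subgroup.mul_mem _ h1 h2

theorem wordLength_prod_le_add (hgenH : Subgroup.closure S_H = ⊤)
    (hinl : ∀ s ∈ S_H, (s, 1) ∈ S)
    (hinr : ∀ i : Fin N, (1, Multiplicative.ofAdd (Pi.single i (1 : ℤ))) ∈ S)
    (g : H × Multiplicative (Fin N → ℤ)) :
    (wordLength S g : ℝ) ≤ wordLength S_H g.1 + ∑ i, |(g.2.toAdd i : ℝ)| := by
  have hS := closure_eq_top_of_prod hgenH hinl hinr
  have h1 : wordLength S ((g.1, 1) : H × Multiplicative (Fin N → ℤ)) ≤ wordLength S_H g.1 :=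
    wordLength_map_le hgenH hS (MonoidHom.inl H _) (fun s hs => .inl (hinl s hs)) g.1
  have h2 := apply_prod_zpow_le_of_subadditive
    (f := fun a : Multiplicative (Fin N → ℤ) => (wordLength S (MonoidHom.inr H _ a) : ℝ))
    (by rw [map_one]; simp) (fun x y => by rw [map_mul]; exact_mod_cast wordLength_mul_le hS _ _)
    (fun x => by rw [map_inv]; exact_mod_cast wordLength_inv_le hS _) Finset.univ
    (fun i => Multiplicative.ofAdd (Pi.single i (1 : ℤ))) g.2.toAdd
  rw [← ofAdd_eq_prod_zpow, ofAdd_toAdd] at h2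
  have h3 : (wordLength S (MonoidHom.inr H _ g.2) : ℝ) ≤ ∑ i, |(g.2.toAdd i : ℝ)| := by
    refine h2.trans (Finset.sum_le_sum fun i _ => mul_le_of_le_one_right (abs_nonneg _) ?_)
    exact_mod_cast wordLength_le_one (.inl (hinr i))
  have h4 := wordLength_mul_le hS (g.1, 1) (MonoidHom.inr H _ g.2)
  rw [MonoidHom.inr_apply, Prod.mk_mul_mk, mul_one, one_mul] at h4
  have h1' : (wordLength S ((g.1, 1) : H × Multiplicative (Fin N → ℤ)) : ℝ) ≤
    wordLength S_H g.1 := by exact_mod_cast h1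
  have h4' : (wordLength S g : ℝ) ≤ wordLength S ((g.1, 1) : H × Multiplicative (Fin N → ℤ)) +
    wordLength S (MonoidHom.inr H _ g.2) := by exact_mod_cast h4
  linarith

theorem torsionFreeAbelianizationProj_surjective (G : Type*) [Group G] :
    Function.Surjective (torsionFreeAbelianizationProj G) :=
  (QuotientGroup.mk'_surjective _).comp QuotientGroup.mk_surjective

theorem exists_comp_torsionFreeAbelianizationProj_eq {G A : Type*} [Group G] [CommGroup A]
    [IsMulTorsionFree A] (f : G →* A) :
    ∃ r : TorsionFreeAbelianization G →* A, ∀ g, r (torsionFreeAbelianizationProj G g) = f g := by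
  refine ⟨QuotientGroup.lift _ (Abelianization.lift f) fun x hx => ?_, fun g => ?_⟩
  · by_contra h
    exact not_isOfFinOrder_of_isMulTorsionFree h ((Abelianization.lift f).isOfFinOrder hx)
  · simp [torsionFreeAbelianizationProj]

/-- The `ℓ¹` norm on `ℤᴺ` is bounded by the word length in the torsion-free abelianization. -/
theorem sum_abs_le_wordLength_torsionFreeAbelianizationProj (hS : Subgroup.closure S = ⊤)
    (hnorm : ∀ x ∈ S, ∑ i, |(x.2.toAdd i : ℝ)| ≤ 1) (g : H × Multiplicative (Fin N → ℤ)) :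
    ∑ i, |(g.2.toAdd i : ℝ)| ≤
      wordLength (torsionFreeAbelianizationProj _ '' S) (torsionFreeAbelianizationProj _ g) := by
  obtain ⟨r, hr⟩ := exists_comp_torsionFreeAbelianizationProj_eq
    (MonoidHom.snd H (Multiplicative (Fin N → ℤ)))
  have hgen : Subgroup.closure (torsionFreeAbelianizationProj _ '' S) = ⊤ := by
    rw [← MonoidHom.map_closure, hS, ← MonoidHom.range_eq_map, MonoidHom.range_eq_top]
    exact torsionFreeAbelianizationProj_surjective _
  have h := le_mul_wordLength hgen (f := fun v => ∑ i, |((r v).toAdd i : ℝ)|) (c := 1)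
    (by simp) ?_ ?_ (torsionFreeAbelianizationProj _ g)
  · simpa only [hr, MonoidHom.coe_snd, one_mul] using h
  · intro x y
    rw [← Finset.sum_add_distrib]
    refine Finset.sum_le_sum fun i _ => ?_
    simpa using abs_add_le ((r x).toAdd i : ℝ) ((r y).toAdd i)
  · rintro _ ⟨x, hx, rfl⟩
    simpa [hr] using hnorm x hx

end ProductWithFreeAbelian

/-- Growth of the automorphism `χ(h,a) = (φ(h), α(h) + ψ(a))` of `G = H × ℤᴺ` (with `H` of
trivial center): up to a multiplicative constant, `|χⁿ(g)|_S` equals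
`|φⁿ(h)|_{S_H} + |χ̄ⁿ(q(g))|`, and `‖χⁿ(g)‖_S` equals `‖φⁿ(h)‖_{S_H} + |χ̄ⁿ(q(g))|`,
where `q` is the projection to the abelianization of `G` modulo torsion and `χ̄` is the
induced automorphism; moreover the growth of `χ̄` on each `q(g) ≠ 1` is `nᵖ·λⁿ` for some
`p ∈ ℕ` and some real algebraic integer `λ ≥ 1`. -/
theorem growth_of_automorphism_of_product_with_free_abelian
    {H : Type*} [Group H] (S_H : Finset H)
    (hgenH : Subgroup.closure (S_H : Set H) = ⊤)
    (hcenter : Subgroup.center H = ⊥) (N : ℕ)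
    (S : Finset (H × Multiplicative (Fin N → ℤ)))
    (hS : ∀ x : H × Multiplicative (Fin N → ℤ), x ∈ S ↔
      ((∃ s ∈ S_H, x = (s, 1)) ∨
        ∃ i : Fin N, x = (1, Multiplicative.ofAdd (Pi.single i (1 : ℤ))) ∨
          x = (1, Multiplicative.ofAdd (-Pi.single i (1 : ℤ)))))
    (φ : H ≃* H) (ψ : (Fin N → ℤ) ≃+ (Fin N → ℤ))
    (α : H →* Multiplicative (Fin N → ℤ))
    (χ : (H × Multiplicative (Fin N → ℤ)) ≃* (H × Multiplicative (Fin N → ℤ)))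
    (hχ : ∀ (h : H) (a : Fin N → ℤ),
      χ (h, Multiplicative.ofAdd a) =
        (φ h, Multiplicative.ofAdd (Multiplicative.toAdd (α h) + ψ a)))
    (q : (H × Multiplicative (Fin N → ℤ)) →*
      TorsionFreeAbelianization (H × Multiplicative (Fin N → ℤ)))
    (hq : q = torsionFreeAbelianizationProj _)
    (χbar : TorsionFreeAbelianization (H × Multiplicative (Fin N → ℤ)) ≃*
      TorsionFreeAbelianization (H × Multiplicative (Fin N → ℤ)))
    (hχbar : ∀ g, χbar (q g) = q (χ g)) :
    (∃ C : ℝ, 1 ≤ C ∧ ∀ (g : H × Multiplicative (Fin N → ℤ)) (n : ℕ),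
      (C⁻¹ * ((wordLength (S_H : Set H) ((⇑φ)^[n] g.1) : ℝ) +
            (wordLength (⇑q '' (S : Set (H × Multiplicative (Fin N → ℤ))))
              ((⇑χbar)^[n] (q g)) : ℝ)) ≤
          (wordLength (S : Set (H × Multiplicative (Fin N → ℤ))) ((⇑χ)^[n] g) : ℝ) ∧
        (wordLength (S : Set (H × Multiplicative (Fin N → ℤ))) ((⇑χ)^[n] g) : ℝ) ≤
          C * ((wordLength (S_H : Set H) ((⇑φ)^[n] g.1) : ℝ) +
            (wordLength (⇑q '' (S : Set (H × Multiplicative (Fin N → ℤ))))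
              ((⇑χbar)^[n] (q g)) : ℝ))) ∧
      (C⁻¹ * ((conjLength (S_H : Set H) ((⇑φ)^[n] g.1) : ℝ) +
            (wordLength (⇑q '' (S : Set (H × Multiplicative (Fin N → ℤ))))
              ((⇑χbar)^[n] (q g)) : ℝ)) ≤
          (conjLength (S : Set (H × Multiplicative (Fin N → ℤ))) ((⇑χ)^[n] g) : ℝ) ∧
        (conjLength (S : Set (H × Multiplicative (Fin N → ℤ))) ((⇑χ)^[n] g) : ℝ) ≤
          C * ((conjLength (S_H : Set H) ((⇑φ)^[n] g.1) : ℝ) +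
            (wordLength (⇑q '' (S : Set (H × Multiplicative (Fin N → ℤ))))
              ((⇑χbar)^[n] (q g)) : ℝ)))) ∧
    (∀ g : H × Multiplicative (Fin N → ℤ), q g ≠ 1 →
      ∃ (p : ℕ) (lam : ℝ), 1 ≤ lam ∧ IsIntegral ℤ lam ∧
        ∃ C : ℝ, 0 < C ∧ ∀ n : ℕ, 1 ≤ n →
          (wordLength (⇑q '' (S : Set (H × Multiplicative (Fin N → ℤ))))
              ((⇑χbar)^[n] (q g)) : ℝ) ≤ C * ((n : ℝ) ^ p * lam ^ n) ∧
          (n : ℝ) ^ p * lam ^ n ≤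
            C * (wordLength (⇑q '' (S : Set (H × Multiplicative (Fin N → ℤ))))
              ((⇑χbar)^[n] (q g)) : ℝ)) := by
  subst hq
  let G := H × Multiplicative (Fin N → ℤ)
  set q := torsionFreeAbelianizationProj G
  have hinl : ∀ s ∈ (S_H : Set H), ((s, 1) : G) ∈ (S : Set G) := fun s hs =>
    (hS _).2 (.inl ⟨s, hs, rfl⟩)
  have hinr : ∀ i : Fin N, ((1, Multiplicative.ofAdd (Pi.single i (1 : ℤ))) : G) ∈ (S : Set G) :=
    fun i => (hS _).2 (.inr ⟨i, .inl rfl⟩)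
  have hgen : Subgroup.closure (S : Set G) = ⊤ := closure_eq_top_of_prod hgenH hinl hinr
  have hgenV : Subgroup.closure (q '' (S : Set G)) = ⊤ := by
    rw [← MonoidHom.map_closure, hgen, ← MonoidHom.range_eq_map, MonoidHom.range_eq_top]
    exact torsionFreeAbelianizationProj_surjective _
  have hnorm : ∀ x ∈ (S : Set G), ∑ i, |(x.2.toAdd i : ℝ)| ≤ 1 := by
    intro x hx
    rcases (hS x).1 hx with ⟨s, -, rfl⟩ | ⟨j, rfl | rfl⟩
    · simp
    all_goals
      rw [Finset.sum_eq_single j (fun i _ hi => by simp [hi]) (by simp)]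
      simp
  have hfst : ∀ g : G, wordLength (S_H : Set H) g.1 ≤ wordLength (S : Set G) g := fun g => by
    refine wordLength_map_le hgen hgenH (MonoidHom.fst H _) (fun x hx => ?_) g
    rcases (hS x).1 hx with ⟨s, hs, rfl⟩ | ⟨j, rfl | rfl⟩
    · exact .inl hs
    all_goals exact .inr rfl
  have hproj : ∀ g : G, wordLength (q '' (S : Set G)) (q g) ≤ wordLength (S : Set G) g :=
    wordLength_map_le hgen hgenV q fun x hx => .inl (Set.mem_image_of_mem q hx)
  have hupper : ∀ g : G, (wordLength (S : Set G) g : ℝ) ≤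
      wordLength (S_H : Set H) g.1 + wordLength (q '' (S : Set G)) (q g) := fun g =>
    (wordLength_prod_le_add hgenH hinl hinr g).trans
      (by gcongr; exact sum_abs_le_wordLength_torsionFreeAbelianizationProj hgen hnorm g)
  have hconj : ∀ x g : G, q (x * g * x⁻¹) = q g := fun x g => by
    rw [map_mul, map_mul, map_inv, mul_comm (q x), mul_inv_cancel_right]
  have hiter₁ : ∀ (n : ℕ) (g : G), φ^[n] g.1 = (χ^[n] g).1 := fun n g =>
    ((Function.Semiconj.iterate_right (f := Prod.fst)
      (fun g : G => congrArg Prod.fst (hχ g.1 g.2.toAdd)) n) g).symm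
  have hiter₂ : ∀ (n : ℕ) (g : G), χbar^[n] (q g) = q (χ^[n] g) := fun n g =>
    ((Function.Semiconj.iterate_right (f := q) (fun g => (hχbar g).symm) n) g).symm
  refine ⟨⟨2, one_le_two, fun g n => ?_⟩, fun g hg =>
    χbar.exists_growth_of_commGroup (S.finite_toSet.image q) hgenV hg⟩
  rw [hiter₁, hiter₂]
  generalize χ^[n] g = g
  have h₁ : (wordLength (S_H : Set H) g.1 : ℝ) ≤ wordLength (S : Set G) g := by
    exact_mod_cast hfst g
  have h₂ : (wordLength (q '' (S : Set G)) (q g) : ℝ) ≤ wordLength (S : Set G) g := by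
    exact_mod_cast hproj g
  obtain ⟨x, hx⟩ := exists_wordLength_eq_conjLength (S : Set G) g
  obtain ⟨y, hy⟩ := exists_wordLength_eq_conjLength (S_H : Set H) g.1
  have h₃ : (conjLength (S_H : Set H) g.1 : ℝ) ≤ conjLength (S : Set G) g := by
    rw [← hx]
    exact_mod_cast (conjLength_le _ g.1 x.1).trans (hfst (x * g * x⁻¹))
  have h₄ : (wordLength (q '' (S : Set G)) (q g) : ℝ) ≤ conjLength (S : Set G) g := by
    rw [← hx, ← hconj x g]
    exact_mod_cast hproj _
  have h₅ : (conjLength (S : Set G) g : ℝ) ≤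
      conjLength (S_H : Set H) g.1 + wordLength (q '' (S : Set G)) (q g) := by
    have h := hupper ((y, 1) * g * (y, 1)⁻¹)
    rw [hconj] at h
    rw [← hy]
    exact le_trans (by exact_mod_cast conjLength_le _ g (y, 1)) h
  have h₆ := hupper g
  have h₇ : (0 : ℝ) ≤ wordLength (S_H : Set H) g.1 := Nat.cast_nonneg _
  have h₈ : (0 : ℝ) ≤ conjLength (S_H : Set H) g.1 := Nat.cast_nonneg _
  have h₉ : (0 : ℝ) ≤ wordLength (q '' (S : Set G)) (q g) := Nat.cast_nonneg _
  refine ⟨⟨?_, ?_⟩, ?_, ?_⟩ <;> linarith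
end

section
/- Let k, m ∈ ℕ, and let G₁, …, G_k be groups, each with trivial center and each directly indecomposable, meaning that whenever N and M are normal subgroups of Gᵢ with N ∩ M = {1} and N·M = Gᵢ, then N = {1} or M = {1}. Let A = ℤᵐ and set G = G₁ × ⋯ × G_k × A. For 1 ≤ i ≤ k, let Hᵢ ≤ G be the subgroup of all elements whose Gⱼ-coordinate is trivial for every j ≠ i (so Hᵢ is the canonical copy of Gᵢ × A inside G). Then for every automorphism χ of G there exists a permutation σ of {1, …, k} such that χ(Hᵢ) = H_{σ(i)} for all i. -/
/-- An isomorphism from a product of centerless groups onto a product of groups maps every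
directly indecomposable factor into a single factor. -/
theorem MulEquiv.exists_pi_factor_map_le {ι κ : Type*} {G : ι → Type*} {K : κ → Type*}
    [∀ i, Group (G i)] [∀ j, Group (K j)]
    (hcenter : ∀ i, Subgroup.center (G i) = ⊥)
    (φ : (∀ i, G i) ≃* (∀ j, K j)) (i : ι) [Nontrivial (G i)]
    (hindec : ∀ P Q : Subgroup (G i), P.Normal → Q.Normal → P ⊓ Q = ⊥ →
      (∀ g : G i, ∃ x ∈ P, ∃ y ∈ Q, g = x * y) → P = ⊥ ∨ Q = ⊥) :
    ∃ j, ∀ x : ∀ i, G i, (∀ l, l ≠ i → x l = 1) → ∀ l, l ≠ j → φ x l = 1 := by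
  classical
  let f (j : κ) : G i →* K j :=
    ((Pi.evalMonoidHom K j).comp φ.toMonoidHom).comp (MonoidHom.mulSingle G i)
  have hf (j : κ) (a : G i) : f j a = φ (Pi.mulSingle i a) j := rfl
  have f_inj (a : G i) (h : ∀ j, f j a = 1) : a = 1 := by
    have h1 : φ (Pi.mulSingle i a) = 1 := funext h
    simpa using h1
  -- The `j`-th component of an element of the `i`-th factor is in the `i`-th factor again.
  have component (j : κ) (a : G i) :
      ∃ b : G i, φ (Pi.mulSingle i b) = Pi.mulSingle j (f j a) := by
    have key : ∀ l, l ≠ i → φ.symm (Pi.mulSingle j (f j a)) l = 1 := by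
      intro l hl
      rw [← Subgroup.mem_bot, ← hcenter l, Subgroup.mem_center_iff]
      intro b
      have hcomm : Commute (Pi.mulSingle l b : ∀ i, G i) (Pi.mulSingle i a) :=
        Pi.mulSingle_commute hl b a
      have hj : φ (Pi.mulSingle l b) j * f j a = f j a * φ (Pi.mulSingle l b) j :=
        congrFun (hcomm.map φ) j
      have hφ : φ (Pi.mulSingle l b) * Pi.mulSingle j (f j a) =
          Pi.mulSingle j (f j a) * φ (Pi.mulSingle l b) := by
        ext t
        by_cases ht : t = j
        · subst ht
          simpa using hj
        · simp [ht]
      have hl := congrFun (congrArg φ.symm hφ) l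
      simpa using hl
    refine ⟨φ.symm (Pi.mulSingle j (f j a)) i, ?_⟩
    rw [← φ.eq_symm_apply]
    ext t
    by_cases ht : t = i
    · subst ht
      simp
    · simp [ht, key t ht]
  let P (j : κ) : Subgroup (G i) := ⨅ l, ⨅ _ : l ≠ j, (f l).ker
  have mem_P {j : κ} {a : G i} : a ∈ P j ↔ ∀ l, l ≠ j → f l a = 1 := by
    simp [P, Subgroup.mem_iInf, MonoidHom.mem_ker]
  have decomp (j : κ) (a : G i) : ∃ x ∈ P j, ∃ y ∈ (f j).ker, a = x * y := by
    obtain ⟨b, hb⟩ := component j a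
    refine ⟨b, mem_P.2 fun l hl => ?_, b⁻¹ * a, ?_, by simp⟩
    · rw [hf, hb, Pi.mulSingle_eq_of_ne hl]
    · have : f j b = f j a := by rw [hf, hb, Pi.mulSingle_eq_same]
      simp [MonoidHom.mem_ker, this]
  have dichotomy (j : κ) : P j = ⊥ ∨ (f j).ker = ⊥ := by
    refine hindec _ _ ⟨fun n hn g => mem_P.2 fun l hl => ?_⟩ inferInstance ?_ (decomp j)
    · simp [mem_P.1 hn l hl]
    · rw [eq_bot_iff]
      rintro a ⟨ha, ha'⟩
      refine f_inj a fun l => ?_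
      by_cases hl : l = j
      · subst hl
        exact ha'
      · exact mem_P.1 ha l hl
  obtain ⟨j, hj⟩ : ∃ j, P j ≠ ⊥ := by
    by_contra! h
    obtain ⟨a, ha⟩ := exists_ne (1 : G i)
    refine ha (f_inj a fun j => ?_)
    obtain ⟨x, hx, y, hy, rfl⟩ := decomp j a
    rw [h j, Subgroup.mem_bot] at hx
    rw [hx, one_mul]
    exact hy
  refine ⟨j, fun x hx l hl => ?_⟩
  have hxi : x = Pi.mulSingle i (x i) := by
    ext t
    by_cases ht : t = i
    · subst ht
      simp
    · simp [ht, hx t ht]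
  obtain ⟨u, hu, v, hv, huv⟩ := decomp j (x i)
  rw [(dichotomy j).resolve_left hj, Subgroup.mem_bot] at hv
  rw [hv, mul_one] at huv
  rw [hxi, huv]
  exact mem_P.1 hu l hl

/-- An automorphism of a product of centerless, directly indecomposable groups permutes the
factors. -/
theorem MulEquiv.exists_perm_pi_factors {ι : Type*} {G : ι → Type*} [∀ i, Group (G i)]
    (hcenter : ∀ i, Subgroup.center (G i) = ⊥)
    (hindec : ∀ i, ∀ P Q : Subgroup (G i), P.Normal → Q.Normal → P ⊓ Q = ⊥ →
      (∀ g : G i, ∃ x ∈ P, ∃ y ∈ Q, g = x * y) → P = ⊥ ∨ Q = ⊥)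
    (φ : (∀ i, G i) ≃* (∀ i, G i)) :
    ∃ σ : Equiv.Perm ι, ∀ i (x : ∀ i, G i),
      (∀ j, j ≠ i → x j = 1) ↔ ∀ j, j ≠ σ i → φ x j = 1 := by
  classical
  let T := {i // Nontrivial (G i)}
  have exists_target (ψ : (∀ i, G i) ≃* (∀ i, G i)) (i : T) :
      ∃ j : T, ∀ x : ∀ i, G i, (∀ l, l ≠ i.1 → x l = 1) → ∀ l, l ≠ j.1 → ψ x l = 1 := by
    have := i.2
    obtain ⟨j, hj⟩ := ψ.exists_pi_factor_map_le hcenter i.1 (hindec i.1)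
    refine ⟨⟨j, ?_⟩, hj⟩
    obtain ⟨a, ha⟩ := exists_ne (1 : G i.1)
    by_contra hnt
    rw [not_nontrivial_iff_subsingleton] at hnt
    refine ha ?_
    have h1 : ψ (Pi.mulSingle i.1 a) = 1 := by
      ext l
      by_cases hl : l = j
      · subst hl
        exact Subsingleton.elim _ _
      · exact hj _ (fun t ht => Pi.mulSingle_eq_of_ne ht a) l hl
    simpa using h1
  have eq_of_le (i j : T)
      (h : ∀ x : ∀ i, G i, (∀ l, l ≠ i.1 → x l = 1) → ∀ l, l ≠ j.1 → x l = 1) : j = i := by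
    have := i.2
    obtain ⟨a, ha⟩ := exists_ne (1 : G i.1)
    by_contra hne
    have := h (Pi.mulSingle i.1 a) (fun t ht => Pi.mulSingle_eq_of_ne ht a) i.1
      fun e => hne (Subtype.ext e.symm)
    exact ha (by simpa using this)
  choose f hf using exists_target φ
  choose g hg using exists_target φ.symm
  let τ : Equiv.Perm T :=
    { toFun := f
      invFun := g
      left_inv := fun i => eq_of_le _ _ fun x hx => by
        simpa using hg (f i) (φ x) (hf i x hx)
      right_inv := fun i => eq_of_le _ _ fun x hx => by
        simpa using hf (g i) (φ.symm x) (hg i x hx) }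
  refine ⟨Equiv.Perm.ofSubtype τ, fun i x => ?_⟩
  by_cases hi : Nontrivial (G i)
  · have hσ : Equiv.Perm.ofSubtype τ i = f ⟨i, hi⟩ :=
      Equiv.Perm.ofSubtype_apply_of_mem τ hi
    rw [hσ]
    refine ⟨hf ⟨i, hi⟩ x, fun h => ?_⟩
    have hgf : g (f ⟨i, hi⟩) = ⟨i, hi⟩ := τ.left_inv _
    have := hg (f ⟨i, hi⟩) (φ x) h
    rwa [hgf, φ.symm_apply_apply] at this
  · rw [Equiv.Perm.ofSubtype_apply_of_not_mem τ hi]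
    rw [not_nontrivial_iff_subsingleton] at hi
    have eq_one (y : ∀ i, G i) : (∀ j, j ≠ i → y j = 1) ↔ y = 1 := by
      refine ⟨fun h => funext fun l => ?_, fun h => by simp [h]⟩
      by_cases hl : l = i
      · subst hl
        exact Subsingleton.elim _ _
      · exact h l hl
    rw [eq_one, eq_one, φ.map_eq_one_iff]

/-- An automorphism of the product of a centerless group `P` and a commutative group `A` induces
an automorphism of `P`. -/
theorem MulEquiv.exists_fst_of_center_eq_bot {P A : Type*} [Group P] [CommGroup A]
    (hcenter : Subgroup.center P = ⊥) (χ : P × A ≃* P × A) :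
    ∃ φ : P ≃* P, ∀ x, (χ x).1 = φ x.1 := by
  have fst_one (ψ : P × A ≃* P × A) (a : A) : (ψ (1, a)).1 = 1 := by
    rw [← Subgroup.mem_bot, ← hcenter, Subgroup.mem_center_iff]
    intro b
    have hcomm : Commute (ψ.symm (b, 1)) (1, a) :=
      Prod.ext (by simp) (by simp [mul_comm])
    have := congrArg Prod.fst (hcomm.map ψ)
    simpa using this
  have fst_eq (ψ : P × A ≃* P × A) (x : P × A) : (ψ x).1 = (ψ (x.1, 1)).1 := by
    have hx : x = (x.1, 1) * (1, x.2) := by simp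
    conv_lhs => rw [hx, map_mul, Prod.fst_mul, fst_one, mul_one]
  refine ⟨{ toFun := fun x => (χ (x, 1)).1
            invFun := fun x => (χ.symm (x, 1)).1
            left_inv := fun x => ?_
            right_inv := fun x => ?_
            map_mul' := fun x y => ?_ }, fst_eq χ⟩
  · beta_reduce
    rw [← fst_eq χ.symm, χ.symm_apply_apply]
  · beta_reduce
    rw [← fst_eq χ, χ.apply_symm_apply]
  · rw [← Prod.fst_mul, ← map_mul, Prod.mk_mul_mk, one_mul]


/-- Let `G = G₁ × ⋯ × G_k × ℤᵐ` where each `Gᵢ` has trivial center and is directly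
indecomposable. Every automorphism of `G` permutes the canonical subgroups
`Hᵢ ≅ Gᵢ × ℤᵐ` (consisting of the elements whose `Gⱼ`-coordinate is trivial for `j ≠ i`). -/
theorem automorphism_permutes_canonical_factors
    (k m : ℕ) (G : Fin k → Type*) [∀ i, Group (G i)]
    (hcenter : ∀ i, Subgroup.center (G i) = ⊥)
    (hindec : ∀ i, ∀ P Q : Subgroup (G i), P.Normal → Q.Normal → P ⊓ Q = ⊥ →
      (∀ g : G i, ∃ x ∈ P, ∃ y ∈ Q, g = x * y) → P = ⊥ ∨ Q = ⊥)
    (χ : ((∀ i, G i) × Multiplicative (Fin m → ℤ)) ≃*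
      ((∀ i, G i) × Multiplicative (Fin m → ℤ))) :
    ∃ σ : Equiv.Perm (Fin k), ∀ i : Fin k,
      ⇑χ '' {x : (∀ i, G i) × Multiplicative (Fin m → ℤ) | ∀ j, j ≠ i → x.1 j = 1} =
        {x : (∀ i, G i) × Multiplicative (Fin m → ℤ) | ∀ j, j ≠ σ i → x.1 j = 1} := by
  have hcenter_pi : Subgroup.center (∀ i, G i) = ⊥ := by
    rw [eq_bot_iff]
    intro x hx
    refine funext fun i => ?_
    rw [Pi.one_apply, ← Subgroup.mem_bot, ← hcenter i, Subgroup.mem_center_iff]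
    intro b
    simpa using congrFun (Subgroup.mem_center_iff.1 hx (Pi.mulSingle i b)) i
  obtain ⟨φ, hφ⟩ := χ.exists_fst_of_center_eq_bot hcenter_pi
  obtain ⟨σ, hσ⟩ := φ.exists_perm_pi_factors hcenter hindec
  refine ⟨σ, fun i => ?_⟩
  ext y
  obtain ⟨x, rfl⟩ := χ.surjective y
  rw [χ.injective.mem_set_image, Set.mem_ofPred_eq, Set.mem_ofPred_eq, hφ]
  exact hσ i x.1
end

section
/- Let U be a group and L a normal subgroup of U. Let K be the group (under composition) of all automorphisms φ of U such that φ(x) = x for every x ∈ L and u⁻¹·φ(u) ∈ L for every u ∈ U. Then: (i) for every φ ∈ K and u ∈ U, the element u⁻¹·φ(u) lies in the center of L and depends only on the coset u·L; and (ii) the map sending φ ∈ K to the function from U/L to the center of L given by u·L ↦ u⁻¹·φ(u) is an injective group homomorphism from K into the direct product, over the cosets of L, of copies of the center of L (with pointwise multiplication). In particular K is abelian, and if L has finite index in U then K embeds into a finite direct power of the center of L. -/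
/-- If an endomorphism fixes a normal subgroup `L` pointwise, then every displacement `u⁻¹ * φ u`
commutes with every element of `L`. -/
theorem commute_inv_mul_apply_of_fixes_normal {U : Type*} [Group U] {L : Subgroup U} [L.Normal]
    {φ : U →* U} (hφ : ∀ x ∈ L, φ x = x) (u : U) {x : U} (hx : x ∈ L) :
    Commute (u⁻¹ * φ u) x := by
  have h := hφ _ (Subgroup.Normal.conj_mem inferInstance x hx u)
  rw [map_mul, map_mul, map_inv, hφ x hx, mul_inv_eq_iff_eq_mul] at h
  rw [commute_iff_eq, mul_assoc, h]
  group

/-- If an endomorphism fixes `L` pointwise and `u⁻¹ * v ∈ L`, then `φ v = φ u * (u⁻¹ * v)`. -/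
theorem apply_eq_apply_mul_of_fixes {U : Type*} [Group U] {L : Subgroup U}
    {φ : U →* U} (hφ : ∀ x ∈ L, φ x = x) {u v : U} (h : u⁻¹ * v ∈ L) :
    φ v = φ u * (u⁻¹ * v) := by
  rw [← hφ _ h, ← map_mul, mul_inv_cancel_left]


/-- Let `L` be a normal subgroup of `U` and let `K` be the group (under composition) of
automorphisms `φ` of `U` fixing `L` pointwise and with `u⁻¹·φ(u) ∈ L` for all `u`.
Then: (i) for `φ ∈ K`, the element `u⁻¹·φ(u)` lies in the center of `L` and depends only on
the coset `u·L`; (ii) the map `φ ↦ (u·L ↦ u⁻¹·φ(u))` is a multiplicative and injective map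
from `K` into the product over cosets of `L` of copies of the center of `L`;
in particular `K` is abelian. -/
theorem pointwise_stabilizer_embeds_in_power_of_center
    {U : Type*} [Group U] (L : Subgroup U) [L.Normal] :
    (∀ φ : U ≃* U, (∀ x ∈ L, φ x = x) → (∀ u : U, u⁻¹ * φ u ∈ L) →
      ∀ u v : U,
        (u⁻¹ * φ u ∈ L ∧ ∀ x ∈ L, (u⁻¹ * φ u) * x = x * (u⁻¹ * φ u)) ∧
        (u⁻¹ * v ∈ L → u⁻¹ * φ u = v⁻¹ * φ v)) ∧
    (∀ φ ψ : U ≃* U,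
      (∀ x ∈ L, φ x = x) → (∀ u : U, u⁻¹ * φ u ∈ L) →
      (∀ x ∈ L, ψ x = x) → (∀ u : U, u⁻¹ * ψ u ∈ L) →
      (∀ u : U, u⁻¹ * φ (ψ u) = (u⁻¹ * φ u) * (u⁻¹ * ψ u)) ∧
      ((∀ u : U, u⁻¹ * φ u = u⁻¹ * ψ u) → φ = ψ) ∧
      (∀ u : U, φ (ψ u) = ψ (φ u))) := by
  refine ⟨fun φ hφ hφL u v => ⟨⟨hφL u, fun x hx => ?_⟩, fun huv => ?_⟩,
    fun φ ψ hφ hφL hψ hψL => ⟨fun u => ?_, fun h => ?_, fun u => ?_⟩⟩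
  · exact commute_inv_mul_apply_of_fixes_normal (φ := φ.toMonoidHom) hφ u hx
  · have hc : (u⁻¹ * φ u) * (u⁻¹ * v) = (u⁻¹ * v) * (u⁻¹ * φ u) :=
      commute_inv_mul_apply_of_fixes_normal (φ := φ.toMonoidHom) hφ u huv
    have hv : φ v = φ u * (u⁻¹ * v) :=
      apply_eq_apply_mul_of_fixes (φ := φ.toMonoidHom) hφ huv
    calc u⁻¹ * φ u = v⁻¹ * u * ((u⁻¹ * v) * (u⁻¹ * φ u)) := by group
      _ = v⁻¹ * φ v := by rw [← hc, hv]; group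
  · have h : φ (ψ u) = φ u * (u⁻¹ * ψ u) :=
      apply_eq_apply_mul_of_fixes (φ := φ.toMonoidHom) hφ (hψL u)
    rw [h, mul_assoc]
  · exact MulEquiv.ext fun u => mul_left_cancel (h u)
  · have h₁ : φ (ψ u) = φ u * (u⁻¹ * ψ u) :=
      apply_eq_apply_mul_of_fixes (φ := φ.toMonoidHom) hφ (hψL u)
    have h₂ : ψ (φ u) = ψ u * (u⁻¹ * φ u) :=
      apply_eq_apply_mul_of_fixes (φ := ψ.toMonoidHom) hψ (hφL u)
    have hc : (u⁻¹ * φ u) * (u⁻¹ * ψ u) = (u⁻¹ * ψ u) * (u⁻¹ * φ u) :=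
      commute_inv_mul_apply_of_fixes_normal (φ := φ.toMonoidHom) hφ u (hψL u)
    rw [h₁, h₂]
    exact mul_left_cancel (a := u⁻¹) (by rw [← mul_assoc, hc, mul_assoc])
end
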